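/- arXiv:2306.10705 — 6 statements merged into one kernel-verified Lean document; each statement's English description precedes it below -/
import Mathlib

section
/- For every continuous functions f, g, a, b : [0,L] → ℝ, the weighted cross term is bounded by the energy density: |∫₀ᴸ x (ρ f(x) a(x) + μ g(x) b(x)) dx| ≤ L·η · (1/2)∫₀ᴸ [ρ f(x)² + μ g(x)² + α₁ a(x)² + β (γ a(x) − b(x))²] dx. -/
/-- Weighted Young inequality, where `k` is the ratio of `|m|` to `√(p q)`. -/
theorem abs_mul_mul_le_of_sq_eq {m k p q : ℝ} (hk : 0 ≤ k) (hp : 0 ≤ p) (hq : 0 ≤ q)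
    (hm : m ^ 2 = k ^ 2 * (p * q)) (x y : ℝ) :
    |m * x * y| ≤ k * (p * x ^ 2 + q * y ^ 2) / 2 := by
  apply abs_le_of_sq_le_sq _ (by positivity)
  have h : (m * x * y) ^ 2 = k ^ 2 * (p * q) * (x * y) ^ 2 := by rw [← hm]; ring
  rw [h]
  nlinarith [sq_nonneg (k * (p * x ^ 2 - q * y ^ 2))]

/-- Pointwise bound of the cross term by the energy density. -/
theorem abs_cross_term_le {ρ β μ α₁ γ η : ℝ} (hρ : 0 < ρ) (hβ : 0 < β) (hμ : 0 < μ)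
    (hα₁ : 0 < α₁) (hη₁ : √(ρ / α₁) + √(μ * γ ^ 2 / α₁) ≤ η)
    (hη₂ : √(μ / β) + √(μ * γ ^ 2 / α₁) ≤ η) (f g a b : ℝ) :
    |ρ * f * a + μ * g * b| ≤
      η / 2 * (ρ * f ^ 2 + μ * g ^ 2 + α₁ * a ^ 2 + β * (γ * a - b) ^ 2) := by
  have hs₁ := Real.sqrt_nonneg (ρ / α₁)
  have hs₂ := Real.sqrt_nonneg (μ * γ ^ 2 / α₁)
  have hs₃ := Real.sqrt_nonneg (μ / β)
  have h₁ := abs_mul_mul_le_of_sq_eq (m := ρ) hs₁ hρ.le hα₁.le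
    (by rw [Real.sq_sqrt (by positivity)]; field_simp) f a
  have h₂ := abs_mul_mul_le_of_sq_eq (m := μ * γ) hs₂ hμ.le hα₁.le
    (by rw [Real.sq_sqrt (by positivity)]; field_simp) g a
  have h₃ := abs_mul_mul_le_of_sq_eq (m := μ) hs₃ hμ.le hβ.le
    (by rw [Real.sq_sqrt (by positivity)]; field_simp) g (γ * a - b)
  have hsplit : ρ * f * a + μ * g * b =
      ρ * f * a + μ * γ * g * a - μ * g * (γ * a - b) := by ring
  have htri : |ρ * f * a + μ * g * b| ≤
      |ρ * f * a| + |μ * γ * g * a| + |μ * g * (γ * a - b)| := by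
    rw [hsplit]
    exact (abs_sub _ _).trans (add_le_add_left (abs_add_le _ _) _)
  have e₁ := mul_le_mul_of_nonneg_right (a := ρ * f ^ 2)
    (show √(ρ / α₁) ≤ η by linarith) (by positivity)
  have e₂ := mul_le_mul_of_nonneg_right (a := μ * g ^ 2) hη₂ (by positivity)
  have e₃ := mul_le_mul_of_nonneg_right (a := α₁ * a ^ 2) hη₁ (by positivity)
  have e₄ := mul_le_mul_of_nonneg_right (a := β * (γ * a - b) ^ 2)
    (show √(μ / β) ≤ η by linarith) (by positivity)
  linarith


/-- For continuous functions `f, g, a, b : [0,L] → ℝ`, the weighted cross term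
is bounded by the energy density:
`|∫₀ᴸ x (ρ f a + μ g b) dx| ≤ L η · (1/2) ∫₀ᴸ [ρ f² + μ g² + α₁ a² + β (γ a − b)²] dx`. -/
theorem cross_term_bounded_by_energy
    (ρ β μ α₁ L γ : ℝ) (hρ : 0 < ρ) (hβ : 0 < β) (hμ : 0 < μ) (hα₁ : 0 < α₁) (hL : 0 < L)
    (η : ℝ)
    (hη : η = max (Real.sqrt (ρ / α₁) + Real.sqrt (μ * γ ^ 2 / α₁))
                  (Real.sqrt (μ / β) + Real.sqrt (μ * γ ^ 2 / α₁)))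
    (f g a b : ℝ → ℝ)
    (hf : ContinuousOn f (Set.Icc 0 L)) (hg : ContinuousOn g (Set.Icc 0 L))
    (ha : ContinuousOn a (Set.Icc 0 L)) (hb : ContinuousOn b (Set.Icc 0 L)) :
    |∫ x in (0:ℝ)..L, x * (ρ * f x * a x + μ * g x * b x)| ≤
      L * η * ((1 / 2) * ∫ x in (0:ℝ)..L,
        ρ * (f x) ^ 2 + μ * (g x) ^ 2 + α₁ * (a x) ^ 2 + β * (γ * a x - b x) ^ 2) := by
  have hpt (x : ℝ) (hx : x ∈ Set.Icc 0 L) :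
      |x * (ρ * f x * a x + μ * g x * b x)| ≤ L * η * (1 / 2) *
        (ρ * (f x) ^ 2 + μ * (g x) ^ 2 + α₁ * (a x) ^ 2 + β * (γ * a x - b x) ^ 2) := by
    rw [abs_mul, abs_of_nonneg hx.1]
    have h := abs_cross_term_le hρ hβ hμ hα₁ (hη ▸ le_max_left _ _) (hη ▸ le_max_right _ _)
      (f x) (g x) (a x) (b x)
    calc _ ≤ _ := mul_le_mul hx.2 h (abs_nonneg _) hL.le
      _ = _ := by ring
  have hcross : ContinuousOn (fun x => |x * (ρ * f x * a x + μ * g x * b x)|)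
      (Set.Icc 0 L) := by fun_prop
  have henergy : ContinuousOn (fun x => L * η * (1 / 2) *
      (ρ * (f x) ^ 2 + μ * (g x) ^ 2 + α₁ * (a x) ^ 2 + β * (γ * a x - b x) ^ 2))
      (Set.Icc 0 L) := by fun_prop
  rw [← mul_assoc, ← intervalIntegral.integral_const_mul]
  exact (intervalIntegral.abs_integral_le_integral_abs hL.le).trans
    (intervalIntegral.integral_mono_on hL.le (hcross.intervalIntegrable_of_Icc hL.le)
      (henergy.intervalIntegrable_of_Icc hL.le) hpt)
end

section
/- For every continuous functions f, g, a, b : [0,L] → ℝ and every δ with 0 < δ < 1/(ηL), setting E := (1/2)∫₀ᴸ [ρ f² + μ g² + α₁ a² + β(γ a − b)²] dx and F := ∫₀ᴸ x (ρ f a + μ g b) dx, the perturbed functional E_δ := E + δF satisfies (1 − δηL)·E ≤ E_δ ≤ (1 + δηL)·E. -/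
/-- Weighted Young inequality: if `c² = s² p q`, then `|c u v| ≤ (s / 2) (p u² + q v²)`. -/
lemma abs_mul_mul_le_of_sq_eq_s1 {c s p q : ℝ} (hs : 0 ≤ s) (hp : 0 ≤ p) (hq : 0 ≤ q)
    (hc : c ^ 2 = s ^ 2 * p * q) (u v : ℝ) :
    |c * u * v| ≤ s / 2 * (p * u ^ 2 + q * v ^ 2) := by
  refine abs_le_of_sq_le_sq ?_ (by positivity)
  have h : (c * u * v) ^ 2 = s ^ 2 * ((p * u ^ 2) * (q * v ^ 2)) := by
    rw [mul_pow, mul_pow, hc]; ring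
  rw [h]
  nlinarith [mul_nonneg (sq_nonneg s) (sq_nonneg (p * u ^ 2 - q * v ^ 2))]

/-- Pointwise bound of the cross terms by the energy density. -/
lemma abs_cross_terms_le_energy_density {ρ β μ α₁ γ η : ℝ} (hρ : 0 < ρ) (hβ : 0 < β)
    (hμ : 0 < μ) (hα₁ : 0 < α₁)
    (h₁ : √(ρ / α₁) + √(μ * γ ^ 2 / α₁) ≤ η) (h₂ : √(μ / β) + √(μ * γ ^ 2 / α₁) ≤ η)
    (f g a b : ℝ) :
    |ρ * f * a + μ * g * b| ≤
      η / 2 * (ρ * f ^ 2 + μ * g ^ 2 + α₁ * a ^ 2 + β * (γ * a - b) ^ 2) := by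
  have hfa := abs_mul_mul_le_of_sq_eq_s1 (c := ρ) (Real.sqrt_nonneg (ρ / α₁)) hρ.le hα₁.le
    (by rw [Real.sq_sqrt (by positivity)]; field_simp) f a
  have hgb := abs_mul_mul_le_of_sq_eq_s1 (c := μ) (Real.sqrt_nonneg (μ / β)) hμ.le hβ.le
    (by rw [Real.sq_sqrt (by positivity)]; field_simp) g (γ * a - b)
  have hga := abs_mul_mul_le_of_sq_eq_s1 (c := μ * γ) (Real.sqrt_nonneg (μ * γ ^ 2 / α₁))
    hμ.le hα₁.le (by rw [Real.sq_sqrt (by positivity)]; field_simp) g a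
  have hs₁ := Real.sqrt_nonneg (ρ / α₁)
  have hs₂ := Real.sqrt_nonneg (μ / β)
  have hs₃ := Real.sqrt_nonneg (μ * γ ^ 2 / α₁)
  set s₁ := √(ρ / α₁)
  set s₂ := √(μ / β)
  set s₃ := √(μ * γ ^ 2 / α₁)
  have kf : s₁ * (ρ * f ^ 2) ≤ η * (ρ * f ^ 2) := by gcongr; linarith
  have kg : (s₂ + s₃) * (μ * g ^ 2) ≤ η * (μ * g ^ 2) := by gcongr
  have ka : (s₁ + s₃) * (α₁ * a ^ 2) ≤ η * (α₁ * a ^ 2) := by gcongr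
  have kb : s₂ * (β * (γ * a - b) ^ 2) ≤ η * (β * (γ * a - b) ^ 2) := by gcongr; linarith
  rw [abs_le] at *
  constructor <;> linarith [hfa.1, hfa.2, hgb.1, hgb.2, hga.1, hga.2]


/-- For continuous `f, g, a, b : [0,L] → ℝ` and `0 < δ < 1/(ηL)`, the perturbed
functional `E_δ := E + δ F` satisfies `(1 − δηL) E ≤ E_δ ≤ (1 + δηL) E`. -/
theorem perturbed_energy_equivalence
    (ρ β μ α₁ L γ : ℝ) (hρ : 0 < ρ) (hβ : 0 < β) (hμ : 0 < μ) (hα₁ : 0 < α₁) (hL : 0 < L)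
    (η : ℝ)
    (hη : η = max (Real.sqrt (ρ / α₁) + Real.sqrt (μ * γ ^ 2 / α₁))
                  (Real.sqrt (μ / β) + Real.sqrt (μ * γ ^ 2 / α₁)))
    (f g a b : ℝ → ℝ)
    (hf : ContinuousOn f (Set.Icc 0 L)) (hg : ContinuousOn g (Set.Icc 0 L))
    (ha : ContinuousOn a (Set.Icc 0 L)) (hb : ContinuousOn b (Set.Icc 0 L))
    (δ : ℝ) (hδ0 : 0 < δ) (hδ1 : δ < 1 / (η * L))
    (E F Eδ : ℝ)
    (hE : E = (1 / 2) * ∫ x in (0:ℝ)..L,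
        ρ * (f x) ^ 2 + μ * (g x) ^ 2 + α₁ * (a x) ^ 2 + β * (γ * a x - b x) ^ 2)
    (hF : F = ∫ x in (0:ℝ)..L, x * (ρ * f x * a x + μ * g x * b x))
    (hEδ : Eδ = E + δ * F) :
    (1 - δ * η * L) * E ≤ Eδ ∧ Eδ ≤ (1 + δ * η * L) * E := by
  have h₁ : √(ρ / α₁) + √(μ * γ ^ 2 / α₁) ≤ η := hη ▸ le_max_left _ _
  have h₂ : √(μ / β) + √(μ * γ ^ 2 / α₁) ≤ η := hη ▸ le_max_right _ _
  have hFE : |F| ≤ η * L * E := by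
    have hbound : ∀ x ∈ Set.Icc 0 L, ‖x * (ρ * f x * a x + μ * g x * b x)‖ ≤
        η * L / 2 * (ρ * (f x) ^ 2 + μ * (g x) ^ 2 + α₁ * (a x) ^ 2
          + β * (γ * a x - b x) ^ 2) := by
      intro x hx
      have h := abs_cross_terms_le_energy_density hρ hβ hμ hα₁ h₁ h₂ (f x) (g x) (a x) (b x)
      rw [Real.norm_eq_abs, abs_mul, abs_of_nonneg hx.1]
      calc _ ≤ L * _ := mul_le_mul hx.2 h (abs_nonneg _) hL.le
        _ = _ := by ring
    have hcont : ContinuousOn (fun x => η * L / 2 * (ρ * (f x) ^ 2 + μ * (g x) ^ 2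
        + α₁ * (a x) ^ 2 + β * (γ * a x - b x) ^ 2)) (Set.uIcc 0 L) := by
      rw [Set.uIcc_of_le hL.le]
      fun_prop
    have h := intervalIntegral.norm_integral_le_of_norm_le (μ := MeasureTheory.volume) hL.le
      (Filter.Eventually.of_forall fun x hx => hbound x (Set.Ioc_subset_Icc_self hx))
      hcont.intervalIntegrable
    rw [intervalIntegral.integral_const_mul, Real.norm_eq_abs, ← hF] at h
    calc |F| ≤ _ := h
      _ = η * L * E := by rw [hE]; ring
  have hδF : |δ * F| ≤ δ * η * L * E := by
    rw [abs_mul, abs_of_pos hδ0]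
    calc δ * |F| ≤ δ * (η * L * E) := by gcongr
      _ = _ := by ring
  rw [abs_le] at hδF
  rw [hEδ]
  constructor <;> linarith [hδF.1, hδF.2]
end

section
/- The functional F(t) := ∫₀ᴸ x (ρ v_t v_x + μ p_t p_x) dx satisfies, for all t > 0, the exact identity dF/dt(t) = −E(t) + (L/2)[β(γ v_x(L,t) − p_x(L,t))² + α₁ v_x(L,t)² + ρ v_t(L,t)² + μ p_t(L,t)²]. -/
/-- Partial derivative in the first (space) variable of `f = f x t`. -/
noncomputable def pdx (f : ℝ → ℝ → ℝ) (x t : ℝ) : ℝ := deriv (fun y => f y t) x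

/-- Partial derivative in the second (time) variable of `f = f x t`. -/
noncomputable def pdt (f : ℝ → ℝ → ℝ) (x t : ℝ) : ℝ := deriv (fun s => f x s) t

open MeasureTheory Function

lemma hasDerivAt_fst_of_contDiff {f : ℝ → ℝ → ℝ} (hf : ContDiff ℝ 1 (uncurry f)) (x t : ℝ) :
    HasDerivAt (fun y => f y t) (fderiv ℝ (uncurry f) (x, t) (1, 0)) x :=
  ((hf.differentiable one_ne_zero (x, t)).hasFDerivAt).comp_hasDerivAt (f := fun y => (y, t)) x
    ((hasDerivAt_id x).prodMk (hasDerivAt_const x t))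

lemma hasDerivAt_snd_of_contDiff {f : ℝ → ℝ → ℝ} (hf : ContDiff ℝ 1 (uncurry f)) (x t : ℝ) :
    HasDerivAt (fun s => f x s) (fderiv ℝ (uncurry f) (x, t) (0, 1)) t :=
  ((hf.differentiable one_ne_zero (x, t)).hasFDerivAt).comp_hasDerivAt (f := fun s => (x, s)) t
    ((hasDerivAt_const t x).prodMk (hasDerivAt_id t))

lemma uncurry_pdx_eq {f : ℝ → ℝ → ℝ} (hf : ContDiff ℝ 1 (uncurry f)) :
    uncurry (pdx f) = fun z => fderiv ℝ (uncurry f) z (1, 0) :=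
  funext fun z => (hasDerivAt_fst_of_contDiff hf z.1 z.2).deriv

lemma uncurry_pdt_eq {f : ℝ → ℝ → ℝ} (hf : ContDiff ℝ 1 (uncurry f)) :
    uncurry (pdt f) = fun z => fderiv ℝ (uncurry f) z (0, 1) :=
  funext fun z => (hasDerivAt_snd_of_contDiff hf z.1 z.2).deriv

lemma hasDerivAt_pdx {f : ℝ → ℝ → ℝ} (hf : ContDiff ℝ 1 (uncurry f)) (x t : ℝ) :
    HasDerivAt (fun y => f y t) (pdx f x t) x :=
  (hasDerivAt_fst_of_contDiff hf x t).differentiableAt.hasDerivAt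

lemma hasDerivAt_pdt {f : ℝ → ℝ → ℝ} (hf : ContDiff ℝ 1 (uncurry f)) (x t : ℝ) :
    HasDerivAt (fun s => f x s) (pdt f x t) t :=
  (hasDerivAt_snd_of_contDiff hf x t).differentiableAt.hasDerivAt

lemma contDiff_uncurry_pdx {f : ℝ → ℝ → ℝ} (hf : ContDiff ℝ 2 (uncurry f)) :
    ContDiff ℝ 1 (uncurry (pdx f)) := by
  rw [uncurry_pdx_eq (hf.of_le one_le_two)]
  exact (hf.fderiv_right (m := 1) (by norm_num)).clm_apply contDiff_const

lemma contDiff_uncurry_pdt {f : ℝ → ℝ → ℝ} (hf : ContDiff ℝ 2 (uncurry f)) :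
    ContDiff ℝ 1 (uncurry (pdt f)) := by
  rw [uncurry_pdt_eq (hf.of_le one_le_two)]
  exact (hf.fderiv_right (m := 1) (by norm_num)).clm_apply contDiff_const

lemma continuous_uncurry_pdx {f : ℝ → ℝ → ℝ} (hf : ContDiff ℝ 1 (uncurry f)) :
    Continuous (uncurry (pdx f)) := by
  rw [uncurry_pdx_eq hf]
  exact (hf.continuous_fderiv one_ne_zero).clm_apply continuous_const

lemma continuous_uncurry_pdt {f : ℝ → ℝ → ℝ} (hf : ContDiff ℝ 1 (uncurry f)) :
    Continuous (uncurry (pdt f)) := by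
  rw [uncurry_pdt_eq hf]
  exact (hf.continuous_fderiv one_ne_zero).clm_apply continuous_const

lemma pdt_pdx_comm {f : ℝ → ℝ → ℝ} (hf : ContDiff ℝ 2 (uncurry f)) (x t : ℝ) :
    pdt (pdx f) x t = pdx (pdt f) x t := by
  have hf1 : ContDiff ℝ 1 (uncurry f) := hf.of_le one_le_two
  have hd : DifferentiableAt ℝ (fderiv ℝ (uncurry f)) (x, t) :=
    (hf.fderiv_right (m := 1) (by norm_num)).differentiable one_ne_zero _
  have hfd : ∀ w u : ℝ × ℝ, fderiv ℝ (fun z => fderiv ℝ (uncurry f) z w) (x, t) u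
      = fderiv ℝ (fderiv ℝ (uncurry f)) (x, t) u w := fun w u => by
    rw [(hd.hasFDerivAt.clm_apply (hasFDerivAt_const w _)).fderiv]
    simp
  have h1 : pdt (pdx f) x t = fderiv ℝ (uncurry (pdx f)) (x, t) (0, 1) :=
    (hasDerivAt_snd_of_contDiff (contDiff_uncurry_pdx hf) x t).deriv
  have h2 : pdx (pdt f) x t = fderiv ℝ (uncurry (pdt f)) (x, t) (1, 0) :=
    (hasDerivAt_fst_of_contDiff (contDiff_uncurry_pdt hf) x t).deriv
  rw [h1, h2, uncurry_pdx_eq hf1, uncurry_pdt_eq hf1, hfd, hfd]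
  exact hf.contDiffAt.isSymmSndFDerivAt (by simp) _ _

/-- Differentiation under the integral sign for a continuously differentiable integrand. -/
lemma hasDerivAt_intervalIntegral_of_contDiff {g : ℝ → ℝ → ℝ} (hg : ContDiff ℝ 1 (uncurry g))
    (a b t : ℝ) :
    HasDerivAt (fun s => ∫ x in a..b, g x s) (∫ x in a..b, pdt g x t) t := by
  have hc : ∀ s, Continuous fun x => g x s := fun s =>
    hg.continuous.comp (by fun_prop : Continuous fun x : ℝ => (x, s))
  have hc' := continuous_uncurry_pdt hg
  obtain ⟨C, hC⟩ := (isCompact_uIcc.prod (isCompact_closedBall t 1) :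
    IsCompact (Set.uIcc a b ×ˢ Metric.closedBall t 1)).exists_bound_of_continuousOn hc'.continuousOn
  refine (intervalIntegral.hasDerivAt_integral_of_dominated_loc_of_deriv_le
    (F := fun s x => g x s) (F' := fun s x => pdt g x s) (bound := fun _ => C)
    (Metric.closedBall_mem_nhds t one_pos)
    (.of_forall fun s => (hc s).aestronglyMeasurable) ((hc t).intervalIntegrable a b)
    ?_ ?_ intervalIntegrable_const ?_).2
  · exact (hc'.comp (by fun_prop : Continuous fun x : ℝ => (x, t))).aestronglyMeasurable
  · exact .of_forall fun x hx s hs => hC (x, s) ⟨Set.uIoc_subset_uIcc hx, hs⟩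
  · exact .of_forall fun x _ s _ => hasDerivAt_pdt hg x s

/-- `F(t) := ∫₀ᴸ x (ρ v_t v_x + μ p_t p_x) dx` satisfies, for all `t > 0`,
`dF/dt = −E(t) + (L/2)[β(γ v_x(L,t) − p_x(L,t))² + α₁ v_x(L,t)² + ρ v_t(L,t)² + μ p_t(L,t)²]`. -/
theorem F_derivative_identity
    (ρ β μ α₁ L γ : ℝ) (hρ : 0 < ρ) (hβ : 0 < β) (hμ : 0 < μ) (hα₁ : 0 < α₁) (hL : 0 < L)
    (α : ℝ) (hα : α = α₁ + γ ^ 2 * β)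
    (η : ℝ)
    (hη : η = max (Real.sqrt (ρ / α₁) + Real.sqrt (μ * γ ^ 2 / α₁))
                  (Real.sqrt (μ / β) + Real.sqrt (μ * γ ^ 2 / α₁)))
    (ξ₁ ξ₂ : ℝ) (hξ₁ : 0 < ξ₁) (hξ₂ : 0 < ξ₂)
    (v p : ℝ → ℝ → ℝ)
    (hv : ContDiff ℝ 2 (Function.uncurry v)) (hp : ContDiff ℝ 2 (Function.uncurry p))
    (heq1 : ∀ x ∈ Set.Ioo (0:ℝ) L, ∀ t > (0:ℝ),
      ρ * pdt (pdt v) x t = α * pdx (pdx v) x t - γ * β * pdx (pdx p) x t)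
    (heq2 : ∀ x ∈ Set.Ioo (0:ℝ) L, ∀ t > (0:ℝ),
      μ * pdt (pdt p) x t = -(γ * β) * pdx (pdx v) x t + β * pdx (pdx p) x t)
    (hbc0 : ∀ t > (0:ℝ), v 0 t = 0 ∧ p 0 t = 0)
    (hbc1 : ∀ t > (0:ℝ), α * pdx v L t - γ * β * pdx p L t = -ξ₁ * pdt v L t)
    (hbc2 : ∀ t > (0:ℝ), -(γ * β) * pdx v L t + β * pdx p L t = -ξ₂ * pdt p L t)
    (E : ℝ → ℝ)
    (hE : ∀ t, E t = (1 / 2) * ∫ x in (0:ℝ)..L,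
        ρ * (pdt v x t) ^ 2 + μ * (pdt p x t) ^ 2 + α₁ * (pdx v x t) ^ 2
          + β * (γ * pdx v x t - pdx p x t) ^ 2)
    (F : ℝ → ℝ)
    (hF : ∀ t, F t = ∫ x in (0:ℝ)..L,
        x * (ρ * pdt v x t * pdx v x t + μ * pdt p x t * pdx p x t))
    : ∀ t > (0:ℝ),
      HasDerivAt F (-E t + (L / 2) * (β * (γ * pdx v L t - pdx p L t) ^ 2
        + α₁ * (pdx v L t) ^ 2 + ρ * (pdt v L t) ^ 2 + μ * (pdt p L t) ^ 2)) t := by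
  intro t ht
  have hvx := contDiff_uncurry_pdx hv
  have hvt := contDiff_uncurry_pdt hv
  have hpx := contDiff_uncurry_pdx hp
  have hpt := contDiff_uncurry_pdt hp
  set g : ℝ → ℝ → ℝ := fun x s =>
    x * (ρ * pdt v x s * pdx v x s + μ * pdt p x s * pdx p x s) with hg_def
  set G : ℝ → ℝ := fun x => ρ * (pdt v x t) ^ 2 + μ * (pdt p x t) ^ 2 + α₁ * (pdx v x t) ^ 2
    + β * (γ * pdx v x t - pdx p x t) ^ 2 with hG_def
  set G' : ℝ → ℝ := fun x => 2 * (ρ * (pdt v x t * pdx (pdt v) x t)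
    + μ * (pdt p x t * pdx (pdt p) x t) + α₁ * (pdx v x t * pdx (pdx v) x t)
    + β * ((γ * pdx v x t - pdx p x t) * (γ * pdx (pdx v) x t - pdx (pdx p) x t))) with hG'_def
  have hg : ContDiff ℝ 1 (uncurry g) :=
    contDiff_fst.mul (((contDiff_const.mul hvt).mul hvx).add ((contDiff_const.mul hpt).mul hpx))
  have hslice : ∀ {f : ℝ → ℝ → ℝ}, Continuous (uncurry f) → Continuous fun x => f x t :=
    fun hf => hf.comp (by fun_prop : Continuous fun x : ℝ => (x, t))
  have cvx := hslice hvx.continuous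
  have cvt := hslice hvt.continuous
  have cpx := hslice hpx.continuous
  have cpt := hslice hpt.continuous
  have cvxx := hslice (continuous_uncurry_pdx hvx)
  have cvtx := hslice (continuous_uncurry_pdx hvt)
  have cpxx := hslice (continuous_uncurry_pdx hpx)
  have cptx := hslice (continuous_uncurry_pdx hpt)
  have cG : Continuous G := by fun_prop
  have cG' : Continuous G' := by fun_prop
  have hGd : ∀ x, HasDerivAt G (G' x) x := fun x => by
    have dv := hasDerivAt_pdx hvx x t
    have dp := hasDerivAt_pdx hpx x t
    refine ((((((hasDerivAt_pdx hvt x t).pow 2).const_mul ρ).add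
      (((hasDerivAt_pdx hpt x t).pow 2).const_mul μ)).add ((dv.pow 2).const_mul α₁)).add
      ((((dv.const_mul γ).sub dp).pow 2).const_mul β)).congr_deriv ?_
    simp only [hG'_def, Pi.sub_apply]
    push_cast
    ring
  have hparts : ∫ x in (0:ℝ)..L, (G x + x * G' x) = L * G L := by
    rw [intervalIntegral.integral_eq_sub_of_hasDerivAt (f := fun x => x * G x)]
    · simp
    · exact fun x _ => ((hasDerivAt_id x).mul (hGd x)).congr_deriv (by simp)
    · exact (by fun_prop : Continuous fun x => G x + x * G' x).intervalIntegrable _ _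
  have hgt : ∀ x ∈ Set.Ioo (0:ℝ) L, pdt g x t = 1 / 2 * ((G x + x * G' x) - G x) := by
    intro x hx
    have h := (((((hasDerivAt_pdt hvt x t).const_mul ρ).mul (hasDerivAt_pdt hvx x t)).add
      (((hasDerivAt_pdt hpt x t).const_mul μ).mul (hasDerivAt_pdt hpx x t))).const_mul x).deriv
    have h' : pdt g x t = _ := h
    rw [h', pdt_pdx_comm hv, pdt_pdx_comm hp, heq1 x hx t ht, heq2 x hx t ht, hα]
    simp only [hG'_def]
    ring
  have hF' : F = fun s => ∫ x in (0:ℝ)..L, g x s := funext hF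
  rw [hF']
  refine (hasDerivAt_intervalIntegral_of_contDiff hg 0 L t).congr_deriv ?_
  rw [intervalIntegral.integral_congr_Ioo_of_le hL.le hgt, intervalIntegral.integral_const_mul,
    intervalIntegral.integral_sub
      ((by fun_prop : Continuous fun x => G x + x * G' x).intervalIntegrable _ _)
      (cG.intervalIntegrable _ _), hparts, hE t]
  simp only [hG_def]
  ring
end

section
/- The bounds (4α₁η² − ρ)/ρ ≥ 3 and βγ²μ/(4α₁βη² − αμ) ≤ 1/3 hold; consequently βγ²μ/(4α₁βη² − αμ) < (4α₁η² − ρ)/ρ, so the open interval (βγ²μ/(4α₁βη² − αμ), (4α₁η² − ρ)/ρ) of admissible values of ε is nonempty. -/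
/-- `(4α₁η² − ρ)/ρ ≥ 3` and `βγ²μ/(4α₁βη² − αμ) ≤ 1/3`; consequently the
open interval of admissible `ε` values is nonempty. -/
theorem eps_interval_nonempty
    (ρ β μ α₁ L γ : ℝ) (hρ : 0 < ρ) (hβ : 0 < β) (hμ : 0 < μ) (hα₁ : 0 < α₁) (hL : 0 < L)
    (α : ℝ) (hα : α = α₁ + γ ^ 2 * β)
    (η : ℝ)
    (hη : η = max (Real.sqrt (ρ / α₁) + Real.sqrt (μ * γ ^ 2 / α₁))
                  (Real.sqrt (μ / β) + Real.sqrt (μ * γ ^ 2 / α₁)))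
    : (4 * α₁ * η ^ 2 - ρ) / ρ ≥ 3 ∧
      β * γ ^ 2 * μ / (4 * α₁ * β * η ^ 2 - α * μ) ≤ 1 / 3 ∧
      β * γ ^ 2 * μ / (4 * α₁ * β * η ^ 2 - α * μ) < (4 * α₁ * η ^ 2 - ρ) / ρ := by
  subst hα
  have sq_bound : ∀ x, 0 ≤ x →
      √x + √(μ * γ ^ 2 / α₁) ≤ η → x + μ * γ ^ 2 / α₁ ≤ η ^ 2 := by
    intro x hx h
    have hy : 0 ≤ μ * γ ^ 2 / α₁ := by positivity
    calc x + μ * γ ^ 2 / α₁ = √x ^ 2 + √(μ * γ ^ 2 / α₁) ^ 2 := by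
          rw [Real.sq_sqrt hx, Real.sq_sqrt hy]
      _ ≤ (√x + √(μ * γ ^ 2 / α₁)) ^ 2 := by
          nlinarith [mul_nonneg (Real.sqrt_nonneg x) (Real.sqrt_nonneg (μ * γ ^ 2 / α₁))]
      _ ≤ η ^ 2 := by gcongr
  have hη₁ := sq_bound (ρ / α₁) (by positivity) (hη ▸ le_max_left _ _)
  have hη₂ := sq_bound (μ / β) (by positivity) (hη ▸ le_max_right _ _)
  have hρ_le : ρ ≤ α₁ * η ^ 2 := by
    calc ρ ≤ ρ + μ * γ ^ 2 := le_add_of_nonneg_right (by positivity)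
      _ = α₁ * (ρ / α₁ + μ * γ ^ 2 / α₁) := by field_simp
      _ ≤ α₁ * η ^ 2 := by gcongr
  have hα_le : (α₁ + γ ^ 2 * β) * μ ≤ α₁ * β * η ^ 2 := by
    calc (α₁ + γ ^ 2 * β) * μ = α₁ * β * (μ / β + μ * γ ^ 2 / α₁) := by field_simp
      _ ≤ α₁ * β * η ^ 2 := by gcongr
  have lower : 3 ≤ (4 * α₁ * η ^ 2 - ρ) / ρ := by
    rw [le_div_iff₀ hρ]
    linarith
  have upper : β * γ ^ 2 * μ / (4 * α₁ * β * η ^ 2 - (α₁ + γ ^ 2 * β) * μ) ≤ 1 / 3 := by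
    have hpos : 0 < α₁ * μ := by positivity
    have hnonneg : 0 ≤ γ ^ 2 * β * μ := by positivity
    rw [div_le_iff₀ (by linarith)]
    linarith
  exact ⟨lower, upper, by linarith⟩
end

section
/- For every ε with βγ²μ/(4α₁βη² − αμ) < ε < (4α₁η² − ρ)/ρ, both discriminants are strictly positive: 4α₁²η² − (1+ε)ρα₁ > 0 and 4(εα₁βη)² − (εα + βγ²)εμα₁β > 0; consequently c₁⁻ < c₁⁺ and c₂⁻ < c₂⁺, so the intervals (c₁⁻, c₁⁺) and (c₂⁻, c₂⁺) are nonempty. -/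
/-- A number dominating `√a + √b` has square at least `a + b`. -/
lemma add_le_sq_of_sqrt_add_sqrt_le {a b x : ℝ} (ha : 0 ≤ a) (hb : 0 ≤ b)
    (h : Real.sqrt a + Real.sqrt b ≤ x) : a + b ≤ x ^ 2 := by
  nlinarith [Real.sq_sqrt ha, Real.sq_sqrt hb, Real.sqrt_nonneg a, Real.sqrt_nonneg b]

lemma sub_sqrt_div_lt_add_sqrt_div {d q : ℝ} (p : ℝ) (hd : 0 < d) (hq : 0 < q) :
    (p - Real.sqrt d) / q < (p + Real.sqrt d) / q := by
  have := Real.sqrt_pos.2 hd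
  gcongr
  linarith

/-- For admissible `ε`, both discriminants are strictly positive, and the
amplifier intervals `(c₁⁻, c₁⁺)` and `(c₂⁻, c₂⁺)` are nonempty. -/
theorem amplifier_intervals_nonempty
    (ρ β μ α₁ L γ : ℝ) (hρ : 0 < ρ) (hβ : 0 < β) (hμ : 0 < μ) (hα₁ : 0 < α₁) (hL : 0 < L)
    (α : ℝ) (hα : α = α₁ + γ ^ 2 * β)
    (η : ℝ)
    (hη : η = max (Real.sqrt (ρ / α₁) + Real.sqrt (μ * γ ^ 2 / α₁))
                  (Real.sqrt (μ / β) + Real.sqrt (μ * γ ^ 2 / α₁)))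
    (ε : ℝ)
    (c₁m c₁p c₂m c₂p : ℝ)
    (hc₁m : c₁m = (2 * α₁ * η - Real.sqrt (4 * α₁ ^ 2 * η ^ 2 - (1 + ε) * ρ * α₁)) / (1 + ε))
    (hc₁p : c₁p = (2 * α₁ * η + Real.sqrt (4 * α₁ ^ 2 * η ^ 2 - (1 + ε) * ρ * α₁)) / (1 + ε))
    (hc₂m : c₂m = (2 * ε * α₁ * β * η -
        Real.sqrt (4 * (ε * α₁ * β * η) ^ 2 - (ε * α + β * γ ^ 2) * ε * μ * α₁ * β)) /
        (ε * α + β * γ ^ 2))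
    (hc₂p : c₂p = (2 * ε * α₁ * β * η +
        Real.sqrt (4 * (ε * α₁ * β * η) ^ 2 - (ε * α + β * γ ^ 2) * ε * μ * α₁ * β)) /
        (ε * α + β * γ ^ 2))
    (hε₁ : β * γ ^ 2 * μ / (4 * α₁ * β * η ^ 2 - α * μ) < ε)
    (hε₂ : ε < (4 * α₁ * η ^ 2 - ρ) / ρ)
    : 4 * α₁ ^ 2 * η ^ 2 - (1 + ε) * ρ * α₁ > 0 ∧
      4 * (ε * α₁ * β * η) ^ 2 - (ε * α + β * γ ^ 2) * ε * μ * α₁ * β > 0 ∧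
      c₁m < c₁p ∧ c₂m < c₂p := by
  have hη_sq : μ / β + μ * γ ^ 2 / α₁ ≤ η ^ 2 :=
    add_le_sq_of_sqrt_add_sqrt_le (by positivity) (by positivity) (hη ▸ le_max_right _ _)
  have hα_pos : 0 < α := by rw [hα]; positivity
  have hαμ : α * μ ≤ α₁ * β * η ^ 2 := by
    calc α * μ = α₁ * β * (μ / β + μ * γ ^ 2 / α₁) := by rw [hα]; field_simp
      _ ≤ α₁ * β * η ^ 2 := by gcongr
  have hden : 0 < 4 * α₁ * β * η ^ 2 - α * μ := by
    nlinarith [mul_pos hα_pos hμ]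
  have hε : 0 < ε := lt_of_le_of_lt (by positivity) hε₁
  rw [div_lt_iff₀ hden] at hε₁
  rw [lt_div_iff₀ hρ] at hε₂
  have hdisc₁ : 0 < 4 * α₁ ^ 2 * η ^ 2 - (1 + ε) * ρ * α₁ := by
    have := mul_pos hα₁ (sub_pos.2 hε₂)
    linarith
  have hdisc₂ : 0 < 4 * (ε * α₁ * β * η) ^ 2 - (ε * α + β * γ ^ 2) * ε * μ * α₁ * β := by
    have := mul_pos (mul_pos (mul_pos hε hα₁) hβ) (sub_pos.2 hε₁)
    linarith
  refine ⟨hdisc₁, hdisc₂, ?_, ?_⟩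
  · rw [hc₁m, hc₁p]
    exact sub_sqrt_div_lt_add_sqrt_div _ hdisc₁ (by positivity)
  · rw [hc₂m, hc₂p]
    exact sub_sqrt_div_lt_add_sqrt_div _ hdisc₂ (by positivity)
end

section
/- For every ε with βγ²μ/(4α₁βη² − αμ) < ε < (4α₁η² − ρ)/ρ, the points ρ/(2η) and μ/(2η) belong to the respective amplifier intervals: c₁⁻ < ρ/(2η) < c₁⁺ and c₂⁻ < μ/(2η) < c₂⁺. -/
/-- A point where an upward-opening quadratic is negative lies strictly between its roots. -/
theorem mem_Ioo_roots_of_quadratic_neg {a b d x : ℝ} (ha : 0 < a)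
    (h : (a * x - b) ^ 2 < d) :
    (b - Real.sqrt d) / a < x ∧ x < (b + Real.sqrt d) / a := by
  obtain ⟨h₁, h₂⟩ := abs_lt.mp (Real.lt_sqrt_of_sq_lt ((sq_abs _).trans_lt h))
  constructor
  · rw [div_lt_iff₀ ha]
    linarith
  · rw [lt_div_iff₀ ha]
    linarith


/-- For admissible `ε`, `ρ/(2η) ∈ (c₁⁻, c₁⁺)` and `μ/(2η) ∈ (c₂⁻, c₂⁺)`. -/
theorem special_points_in_intervals
    (ρ β μ α₁ L γ : ℝ) (hρ : 0 < ρ) (hβ : 0 < β) (hμ : 0 < μ) (hα₁ : 0 < α₁) (hL : 0 < L)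
    (α : ℝ) (hα : α = α₁ + γ ^ 2 * β)
    (η : ℝ)
    (hη : η = max (Real.sqrt (ρ / α₁) + Real.sqrt (μ * γ ^ 2 / α₁))
                  (Real.sqrt (μ / β) + Real.sqrt (μ * γ ^ 2 / α₁)))
    (ε : ℝ)
    (c₁m c₁p c₂m c₂p : ℝ)
    (hc₁m : c₁m = (2 * α₁ * η - Real.sqrt (4 * α₁ ^ 2 * η ^ 2 - (1 + ε) * ρ * α₁)) / (1 + ε))
    (hc₁p : c₁p = (2 * α₁ * η + Real.sqrt (4 * α₁ ^ 2 * η ^ 2 - (1 + ε) * ρ * α₁)) / (1 + ε))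
    (hc₂m : c₂m = (2 * ε * α₁ * β * η -
        Real.sqrt (4 * (ε * α₁ * β * η) ^ 2 - (ε * α + β * γ ^ 2) * ε * μ * α₁ * β)) /
        (ε * α + β * γ ^ 2))
    (hc₂p : c₂p = (2 * ε * α₁ * β * η +
        Real.sqrt (4 * (ε * α₁ * β * η) ^ 2 - (ε * α + β * γ ^ 2) * ε * μ * α₁ * β)) /
        (ε * α + β * γ ^ 2))
    (hε₁ : β * γ ^ 2 * μ / (4 * α₁ * β * η ^ 2 - α * μ) < ε)
    (hε₂ : ε < (4 * α₁ * η ^ 2 - ρ) / ρ)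
    : (c₁m < ρ / (2 * η) ∧ ρ / (2 * η) < c₁p) ∧
      (c₂m < μ / (2 * η) ∧ μ / (2 * η) < c₂p) := by
  have hη₂ : Real.sqrt (μ / β) + Real.sqrt (μ * γ ^ 2 / α₁) ≤ η := hη ▸ le_max_right _ _
  have hs : 0 < Real.sqrt (μ / β) := Real.sqrt_pos.mpr (by positivity)
  have ht : 0 ≤ Real.sqrt (μ * γ ^ 2 / α₁) := Real.sqrt_nonneg _
  have hη₀ : 0 < η := by linarith
  have hα₀ : 0 < α := hα ▸ by positivity
  have hsq : μ / β + μ * γ ^ 2 / α₁ ≤ η ^ 2 := by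
    rw [← Real.sq_sqrt (show 0 ≤ μ / β by positivity),
      ← Real.sq_sqrt (show 0 ≤ μ * γ ^ 2 / α₁ by positivity)]
    nlinarith [mul_nonneg hs.le ht]
  have hαμ : α * μ ≤ α₁ * β * η ^ 2 := by
    calc α * μ = α₁ * β * (μ / β + μ * γ ^ 2 / α₁) := by
          rw [hα]
          field_simp
      _ ≤ α₁ * β * η ^ 2 := by gcongr
  have hden : 0 < 4 * α₁ * β * η ^ 2 - α * μ := by nlinarith [mul_pos hα₀ hμ]
  have hε : 0 < ε := lt_of_le_of_lt (by positivity) hε₁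
  rw [div_lt_iff₀ hden] at hε₁
  rw [lt_div_iff₀ hρ] at hε₂
  have hA : 0 < ε * α + β * γ ^ 2 := by positivity
  subst hc₁m hc₁p hc₂m hc₂p
  constructor
  · refine mem_Ioo_roots_of_quadratic_neg (by positivity) ?_
    have hx : 2 * η * (ρ / (2 * η)) = ρ := by field_simp
    have hx₀ : 0 < ρ / (2 * η) := by positivity
    set x := ρ / (2 * η)
    have key : (1 + ε) * x ^ 2 < α₁ * ρ := by
      have h : (1 + ε) * (2 * η * x) < 4 * α₁ * η ^ 2 := by
        rw [hx]
        linarith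
      have h' : (1 + ε) * x < 2 * α₁ * η := by nlinarith
      nlinarith [mul_lt_mul_of_pos_right h' hx₀]
    have h := mul_lt_mul_of_pos_left key (show 0 < 1 + ε by positivity)
    linear_combination h - 2 * (1 + ε) * α₁ * hx
  · refine mem_Ioo_roots_of_quadratic_neg hA ?_
    have hx : 2 * η * (μ / (2 * η)) = μ := by field_simp
    have hx₀ : 0 < μ / (2 * η) := by positivity
    set x := μ / (2 * η)
    have key : (ε * α + β * γ ^ 2) * x ^ 2 < ε * α₁ * β * μ := by
      have h : (ε * α + β * γ ^ 2) * (2 * η * x) < 4 * ε * α₁ * β * η ^ 2 := by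
        rw [hx]
        linarith
      have h' : (ε * α + β * γ ^ 2) * x < 2 * ε * α₁ * β * η := by nlinarith
      linear_combination mul_lt_mul_of_pos_right h' hx₀ + ε * α₁ * β * hx
    have h := mul_lt_mul_of_pos_left key hA
    linear_combination h - 2 * (ε * α + β * γ ^ 2) * ε * α₁ * β * hx
end
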